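/- A normal invertible bounded operator T on a complex Hilbert space is unitary if and only if ‖Tᵏ‖ ≤ c for all k ∈ ℤ for some constant c. In particular, a normal operator that is similar to a unitary operator is itself unitary. -/

import Mathlib

open ContinuousLinearMap

lemma aux_contr {E : Type*} [NormedAddCommGroup E] (f : E → E) (c : ℝ)
    (h : ∀ x, ‖f x‖ ^ 2 ≤ ‖f (f x)‖ * ‖x‖) (hb : ∀ (n : ℕ) x, ‖f^[n] x‖ ≤ c * ‖x‖) (x : E) :
    ‖f x‖ ≤ ‖x‖ := by
  by_contra! hlt
  have hx : 0 < ‖x‖ := by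
    rcases (norm_nonneg x).eq_or_lt with h0 | h0
    · have h1 := hb 1 x
      simp only [Function.iterate_one, ← h0, mul_zero] at h1
      linarith [norm_nonneg (f x)]
    · exact h0
  set r := ‖f x‖ / ‖x‖ with hr
  have hr1 : 1 < r := (one_lt_div hx).2 hlt
  have key : ∀ n : ℕ, 0 < ‖f^[n] x‖ ∧ r * ‖f^[n] x‖ ≤ ‖f^[n+1] x‖ := by
    intro n
    induction n with
    | zero => simp only [Function.iterate_zero, id, zero_add, Function.iterate_one]
              exact ⟨hx, by rw [hr, div_mul_cancel₀ _ hx.ne']⟩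
    | succ n ih =>
      obtain ⟨h1, h2⟩ := ih
      have h3 : 0 < ‖f^[n+1] x‖ := lt_of_lt_of_le (by positivity) h2
      refine ⟨h3, ?_⟩
      have h4 := h (f^[n] x)
      rw [← Function.iterate_succ_apply' f, ← Function.iterate_succ_apply' f] at h4
      simp only [Nat.succ_eq_add_one] at h4
      have h5 : r * ‖f^[n+1] x‖ * ‖f^[n] x‖ ≤ ‖f^[n+1+1] x‖ * ‖f^[n] x‖ := by nlinarith
      exact le_of_mul_le_mul_right h5 h1
  have key2 : ∀ n : ℕ, r ^ n * ‖x‖ ≤ ‖f^[n] x‖ := by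
    intro n
    induction n with
    | zero => simp
    | succ n ih =>
      have := (key n).2
      rw [pow_succ]
      nlinarith
  obtain ⟨n, hn⟩ := pow_unbounded_of_one_lt c hr1
  have := (key2 n).trans (hb n x)
  nlinarith

lemma aux_iso {E : Type*} [NormedAddCommGroup E] [NormedSpace ℂ E] (W : E ≃L[ℂ] E)
    (hW : ∀ x, ‖W x‖ = ‖x‖) (k : ℤ) : ∀ x, ‖(W ^ k : E ≃L[ℂ] E) x‖ = ‖x‖ := by
  have hn : ∀ (n : ℕ) x, ‖(W ^ n : E ≃L[ℂ] E) x‖ = ‖x‖ := by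
    intro n
    induction n with
    | zero => intro x; rfl
    | succ n ih => intro x; rw [pow_succ]; exact (ih _).trans (hW x)
  intro x
  obtain ⟨n, rfl | rfl⟩ := k.eq_nat_or_neg
  · simpa using hn n x
  · have h1 := hn n ((W ^ (-(n:ℤ)) : E ≃L[ℂ] E) x)
    have h2 : (W ^ n * W ^ (-(n:ℤ)) : E ≃L[ℂ] E) = 1 := by simp
    have h3 : (W ^ n : E ≃L[ℂ] E) ((W ^ (-(n:ℤ)) : E ≃L[ℂ] E) x) = x :=
      congrArg (fun A : E ≃L[ℂ] E => A x) h2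
    rw [← h1, h3]

lemma aux_iter {E : Type*} [NormedAddCommGroup E] [NormedSpace ℂ E] (W : E ≃L[ℂ] E) (n : ℕ)
    (x : E) : (W ^ n : E ≃L[ℂ] E) x = W^[n] x := by
  induction n generalizing x with
  | zero => rfl
  | succ n ih => rw [pow_succ, Function.iterate_succ_apply]; exact ih _



/-- A normal invertible bounded operator `T` on a complex Hilbert space is unitary if and
only if its integer powers are uniformly bounded (`‖Tᵏ‖ ≤ c` for all `k ∈ ℤ`). In
particular, a normal operator similar to a unitary operator is itself unitary. -/
theorem normal_unitary_iff_uniformly_bounded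
    {ℍ : Type*} [NormedAddCommGroup ℍ] [InnerProductSpace ℂ ℍ] [CompleteSpace ℍ]
    (T : ℍ ≃L[ℂ] ℍ)
    (hnormal : (T : ℍ →L[ℂ] ℍ) * adjoint (T : ℍ →L[ℂ] ℍ)
      = adjoint (T : ℍ →L[ℂ] ℍ) * (T : ℍ →L[ℂ] ℍ)) :
    ((∀ x : ℍ, ‖T x‖ = ‖x‖) ↔
      ∃ c : ℝ, ∀ k : ℤ, ‖((T ^ k : ℍ ≃L[ℂ] ℍ) : ℍ →L[ℂ] ℍ)‖ ≤ c) ∧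
    (∀ S : ℍ ≃L[ℂ] ℍ, (∀ x : ℍ, ‖(S * T * S⁻¹ : ℍ ≃L[ℂ] ℍ) x‖ = ‖x‖) →
      ∀ x : ℍ, ‖T x‖ = ‖x‖) := by
  have hn : ∀ y : ℍ, ‖adjoint (T : ℍ →L[ℂ] ℍ) y‖ = ‖T y‖ := by
    intro y
    have h := congrArg (fun A : ℍ →L[ℂ] ℍ => inner ℂ (A y) y) hnormal
    simp only [ContinuousLinearMap.mul_apply] at h
    rw [ContinuousLinearMap.adjoint_inner_left, ← ContinuousLinearMap.adjoint_inner_right,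
      inner_self_eq_norm_sq_to_K, inner_self_eq_norm_sq_to_K] at h
    have h' : ‖adjoint (T : ℍ →L[ℂ] ℍ) y‖ ^ 2 = ‖T y‖ ^ 2 := by exact_mod_cast h
    exact (sq_eq_sq₀ (norm_nonneg _) (norm_nonneg _)).1 h'
  have hlc : ∀ x : ℍ, ‖T x‖ ^ 2 ≤ ‖T (T x)‖ * ‖x‖ := by
    intro x
    rw [← hn (T x)]
    have h1 := norm_inner_le_norm (𝕜 := ℂ) (adjoint (T : ℍ →L[ℂ] ℍ) (T x)) x
    rw [ContinuousLinearMap.adjoint_inner_left] at h1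
    have h2 : ‖inner ℂ (T x) ((T : ℍ →L[ℂ] ℍ) x)‖ = ‖T x‖ ^ 2 := by
      simp [inner_self_eq_norm_sq_to_K]
    rwa [h2] at h1
  have main : (∃ c : ℝ, ∀ k : ℤ, ‖((T ^ k : ℍ ≃L[ℂ] ℍ) : ℍ →L[ℂ] ℍ)‖ ≤ c) →
      ∀ x : ℍ, ‖T x‖ = ‖x‖ := by
    rintro ⟨c, hc⟩ x
    have hb : ∀ (k : ℤ) (x : ℍ), ‖(T ^ k : ℍ ≃L[ℂ] ℍ) x‖ ≤ c * ‖x‖ := fun k x =>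
      ((T ^ k : ℍ ≃L[ℂ] ℍ) : ℍ →L[ℂ] ℍ).le_of_opNorm_le (hc k) x
    have hT : ∀ y : ℍ, T ((T⁻¹ : ℍ ≃L[ℂ] ℍ) y) = y := fun y => T.apply_symm_apply y
    have hT' : ∀ y : ℍ, (T⁻¹ : ℍ ≃L[ℂ] ℍ) (T y) = y := fun y => T.symm_apply_apply y
    refine le_antisymm (aux_contr T c hlc (fun n x => ?_) x) ?_
    · rw [← aux_iter]; simpa using hb n x
    · have := aux_contr (T⁻¹ : ℍ ≃L[ℂ] ℍ) c (fun x => ?_) (fun n x => ?_) (T x)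
      · rwa [hT'] at this
      · have := hlc ((T⁻¹ : ℍ ≃L[ℂ] ℍ) ((T⁻¹ : ℍ ≃L[ℂ] ℍ) x))
        rw [hT, hT] at this
        linarith
      · rw [← aux_iter]; simpa using hb (-n) x
  refine ⟨⟨fun h => ⟨1, fun k => ?_⟩, main⟩, fun S hS => main ?_⟩
  · refine ContinuousLinearMap.opNorm_le_bound _ zero_le_one fun x => ?_
    rw [one_mul]
    exact (aux_iso T h k x).le
  · refine ⟨‖((S⁻¹ : ℍ ≃L[ℂ] ℍ) : ℍ →L[ℂ] ℍ)‖ * ‖(S : ℍ →L[ℂ] ℍ)‖, fun k => ?_⟩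
    refine ContinuousLinearMap.opNorm_le_bound _ (by positivity) fun x => ?_
    have h1 : T ^ k = S⁻¹ * (S * T * S⁻¹) ^ k * S := by rw [conj_zpow]; group
    have h2 := aux_iso _ hS k (S x)
    have h3 : (T ^ k : ℍ ≃L[ℂ] ℍ) x
        = ((S⁻¹ : ℍ ≃L[ℂ] ℍ) : ℍ →L[ℂ] ℍ) (((S * T * S⁻¹) ^ k : ℍ ≃L[ℂ] ℍ) (S x)) := by
      rw [h1]; rfl
    change ‖(T ^ k : ℍ ≃L[ℂ] ℍ) x‖ ≤ _
    rw [h3]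
    refine (ContinuousLinearMap.le_opNorm _ _).trans ?_
    rw [h2, mul_assoc]
    exact mul_le_mul_of_nonneg_left ((S : ℍ →L[ℂ] ℍ).le_opNorm x) (norm_nonneg _)
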